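/- Fix the bids b of all buyers and the bids s_{-j} of all sellers other than j. Suppose that for some bid s_j, seller j is matched in M*(b, (s_j, s_{-j})) to a buyer i*. Then for every other bid s'_j, if seller j is matched to some buyer in M*(b, (s'_j, s_{-j})), that buyer must be i*. -/

import Mathlib

open Finset

noncomputable section

/-- The weight of a set of buyer–seller edges `M` under buyer bids `b` and seller bids `s`:
`∑_{(i,j)∈M} (b i − s j)`. -/
def matchWeight {m n : ℕ} (b : Fin m → ℝ) (s : Fin n → ℝ)
    (M : Finset (Fin m × Fin n)) : ℝ :=
  ∑ e ∈ M, (b e.1 - s e.2)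

/-- A set of edges is a matching: no two distinct edges share a buyer or share a seller. -/
def IsMatching {m n : ℕ} (M : Finset (Fin m × Fin n)) : Prop :=
  ∀ e ∈ M, ∀ e' ∈ M, e ≠ e' → e.1 ≠ e'.1 ∧ e.2 ≠ e'.2

/-- A two-sided matching market with `m` buyers and `n` sellers: a finite edge set `E`,
a nonempty downward-closed family `Fam` of matchings contained in `E`, a fixed strict
linear tie-breaking order `tb` on `Fam`, and the selection `Mstar b s` of the `tb`-least
maximum-weight member of `Fam`. -/
structure MarketSetup (m n : ℕ) where
  E : Finset (Fin m × Fin n)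
  Fam : Finset (Finset (Fin m × Fin n))
  tb : Finset (Fin m × Fin n) → Finset (Fin m × Fin n) → Prop
  Mstar : (Fin m → ℝ) → (Fin n → ℝ) → Finset (Fin m × Fin n)
  empty_mem : ∅ ∈ Fam
  subset_E : ∀ M ∈ Fam, M ⊆ E
  matching : ∀ M ∈ Fam, IsMatching M
  downward_closed : ∀ M ∈ Fam, ∀ M' ⊆ M, M' ∈ Fam
  tb_irrefl : ∀ M ∈ Fam, ¬ tb M M
  tb_trans : ∀ M₁ ∈ Fam, ∀ M₂ ∈ Fam, ∀ M₃ ∈ Fam, tb M₁ M₂ → tb M₂ M₃ → tb M₁ M₃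
  tb_total : ∀ M₁ ∈ Fam, ∀ M₂ ∈ Fam, M₁ ≠ M₂ → tb M₁ M₂ ∨ tb M₂ M₁
  Mstar_mem : ∀ b s, Mstar b s ∈ Fam
  Mstar_max : ∀ b s, ∀ M ∈ Fam, matchWeight b s M ≤ matchWeight b s (Mstar b s)
  Mstar_lt : ∀ b s, ∀ M ∈ Fam,
      matchWeight b s M = matchWeight b s (Mstar b s) → M ≠ Mstar b s →
      tb (Mstar b s) M

/-- If seller `j` is matched in the matching `M`, replacing her bid by `x` shifts the weight of `M`
by `s j - x`, whichever buyer she is matched to. -/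
theorem IsMatching.matchWeight_update {m n : ℕ} {M : Finset (Fin m × Fin n)} (hM : IsMatching M)
    (b : Fin m → ℝ) (s : Fin n → ℝ) {i : Fin m} {j : Fin n} (h : (i, j) ∈ M) (x : ℝ) :
    matchWeight b (Function.update s j x) M = matchWeight b s M + (s j - x) := by
  have hrest : ∑ e ∈ M.erase (i, j), (b e.1 - Function.update s j x e.2) =
      ∑ e ∈ M.erase (i, j), (b e.1 - s e.2) := by
    refine Finset.sum_congr rfl fun e he => ?_
    obtain ⟨hne, he⟩ := Finset.mem_erase.1 he
    rw [Function.update_of_ne (hM e he _ h hne).2]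
  unfold matchWeight
  rw [← Finset.add_sum_erase _ _ h, ← Finset.add_sum_erase _ _ h, hrest]
  simp only [Function.update_self]
  ring

/-- Fixing `b` and `s₋ⱼ`, if seller `j` is matched to buyer `i*` in
`M*(b, (sⱼ, s₋ⱼ))` for some bid `sⱼ`, then for every other bid `s'ⱼ`, whenever seller `j`
is matched to some buyer `i'` in `M*(b, (s'ⱼ, s₋ⱼ))`, that buyer is `i*`. -/
theorem seller_partner_stable {m n : ℕ} (mk : MarketSetup m n)
    (b : Fin m → ℝ) (s : Fin n → ℝ) (j : Fin n)
    (sj sj' : ℝ) (istar i' : Fin m)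
    (hi : (istar, j) ∈ mk.Mstar b (Function.update s j sj))
    (hi' : (i', j) ∈ mk.Mstar b (Function.update s j sj')) :
    i' = istar := by
  have hM := mk.Mstar_mem b (Function.update s j sj)
  have hM' := mk.Mstar_mem b (Function.update s j sj')
  have hle := mk.Mstar_max b (Function.update s j sj) _ hM'
  have hle' := mk.Mstar_max b (Function.update s j sj') _ hM
  have hlt := mk.Mstar_lt b (Function.update s j sj) _ hM'
  have hlt' := mk.Mstar_lt b (Function.update s j sj') _ hM
  simp only [(mk.matching _ hM).matchWeight_update b s hi,
    (mk.matching _ hM').matchWeight_update b s hi'] at hle hle' hlt hlt'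
  have heq : mk.Mstar b (Function.update s j sj) = mk.Mstar b (Function.update s j sj') := by
    by_contra hne
    exact mk.tb_irrefl _ hM (mk.tb_trans _ hM _ hM' _ hM
      (hlt (by linarith) (Ne.symm hne)) (hlt' (by linarith) hne))
  rw [← heq] at hi'
  by_contra hne
  exact (mk.matching _ hM _ hi' _ hi fun h => hne (congrArg Prod.fst h)).2 rfl
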